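/- For every G ∈ Sp(2g,ℤ) and w ∈ ℍ_g, Σ(𝔐(G,w)) = (G⁻¹)ᵀ Σ(w) G⁻¹, where 𝔐(G,w) = (Pw+Q)(Rw+S)⁻¹ and Σ(λ+iμ) = [[μ⁻¹, −μ⁻¹λ],[−λμ⁻¹, μ+λμ⁻¹λ]]. -/

import Mathlib

open Matrix

/-- The Siegel map Σ(λ+iμ) = [[μ⁻¹, −μ⁻¹λ],[−λμ⁻¹, μ+λμ⁻¹λ]]. -/
noncomputable def SigmaM {n : Type*} [Fintype n] [DecidableEq n] (l m : Matrix n n ℝ) :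
    Matrix (n ⊕ n) (n ⊕ n) ℝ :=
  Matrix.fromBlocks m⁻¹ (-(m⁻¹ * l)) (-(l * m⁻¹)) (m + l * m⁻¹ * l)

/-- Σ applied to a point of the Siegel upper half plane, via real and imaginary parts. -/
noncomputable def SigmaC {n : Type*} [Fintype n] [DecidableEq n] (w : Matrix n n ℂ) :
    Matrix (n ⊕ n) (n ⊕ n) ℝ :=
  SigmaM (w.map Complex.re) (w.map Complex.im)

section SiegelAction

variable {n : Type*} [Fintype n]

theorem Matrix.ext_re_im {m k : Type*} {M N : Matrix m k ℂ}
    (hre : M.map Complex.re = N.map Complex.re) (him : M.map Complex.im = N.map Complex.im) :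
    M = N := by
  ext i j
  exact Complex.ext (congrFun₂ hre i j) (congrFun₂ him i j)

theorem Matrix.conjTranspose_sub_self_of_transpose_eq {m : Type*} {w : Matrix m m ℂ}
    (hw : wᵀ = w) : wᴴ - w = (-2 * Complex.I) • (w.map Complex.im).map Complex.ofReal := by
  ext i j
  have : w j i = w i j := congrFun₂ hw i j
  apply Complex.ext <;> simp [this]
  ring

theorem Matrix.map_re_ofReal_mul_add (A B : Matrix n n ℝ) (w : Matrix n n ℂ) :
    (A.map Complex.ofReal * w + B.map Complex.ofReal).map Complex.re =
      A * w.map Complex.re + B := by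
  ext i j
  simp [mul_apply]

theorem Matrix.map_im_ofReal_mul_add (A B : Matrix n n ℝ) (w : Matrix n n ℂ) :
    (A.map Complex.ofReal * w + B.map Complex.ofReal).map Complex.im =
      A * w.map Complex.im := by
  ext i j
  simp [mul_apply]

theorem Matrix.ofReal_mul_add_eq_iff (A B : Matrix n n ℝ) (w N : Matrix n n ℂ) :
    A.map Complex.ofReal * w + B.map Complex.ofReal = N ↔
      A * w.map Complex.re + B = N.map Complex.re ∧ A * w.map Complex.im = N.map Complex.im := by
  rw [← map_re_ofReal_mul_add A B w, ← map_im_ofReal_mul_add A B w]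
  exact ⟨fun h => by rw [h]; exact ⟨rfl, rfl⟩, fun h => ext_re_im h.1 h.2⟩

theorem Matrix.re_star_dotProduct_ofReal_mulVec (m : Matrix n n ℝ) (v : n → ℂ) :
    (star v ⬝ᵥ m.map Complex.ofReal *ᵥ v).re =
      (fun i => (v i).re) ⬝ᵥ m *ᵥ (fun i => (v i).re) +
        (fun i => (v i).im) ⬝ᵥ m *ᵥ (fun i => (v i).im) := by
  simp [dotProduct, mulVec, Complex.re_sum, Complex.im_sum, Finset.sum_add_distrib]

theorem Matrix.PosDef.eq_zero_of_star_dotProduct_ofReal_mulVec {m : Matrix n n ℝ} (hm : m.PosDef)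
    {v : n → ℂ} (hv : star v ⬝ᵥ m.map Complex.ofReal *ᵥ v = 0) : v = 0 := by
  have h := m.re_star_dotProduct_ofReal_mulVec v
  rw [hv, Complex.zero_re] at h
  have hre := hm.posSemidef.dotProduct_mulVec_nonneg (fun i => (v i).re)
  have him := hm.posSemidef.dotProduct_mulVec_nonneg (fun i => (v i).im)
  rw [star_trivial] at hre him
  have key (x : n → ℝ) (hx : x ⬝ᵥ m *ᵥ x = 0) : x = 0 := by
    by_contra hne
    have := hm.dotProduct_mulVec_pos hne
    rw [star_trivial] at this
    exact this.ne' hx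
  funext i
  have hre0 := key (fun i => (v i).re) (by linarith)
  have him0 := key (fun i => (v i).im) (by linarith)
  exact Complex.ext (congrFun hre0 i) (congrFun him0 i)

variable [DecidableEq n]

/-- `SigmaC w` is the only real matrix whose complexification acts on the columns of `[w; 1]` as
`I • J`. -/
theorem eq_SigmaC_iff (X : Matrix (n ⊕ n) (n ⊕ n) ℝ) (w : Matrix n n ℂ)
    (hw : IsUnit (w.map Complex.im).det) :
    X = SigmaC w ↔ X.map Complex.ofReal * fromRows w (1 : Matrix n n ℂ) =
      Complex.I • ((fromBlocks 0 1 (-1) 0 : Matrix (n ⊕ n) (n ⊕ n) ℂ) *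
        fromRows w (1 : Matrix n n ℂ)) := by
  obtain ⟨A, B, C, D, rfl⟩ : ∃ A B C D, X = fromBlocks A B C D :=
    ⟨_, _, _, _, (fromBlocks_toBlocks X).symm⟩
  have re1 : (Complex.I • (1 : Matrix n n ℂ)).map Complex.re = 0 := by
    ext i j; by_cases h : i = j <;> simp [one_apply, h]
  have im1 : (Complex.I • (1 : Matrix n n ℂ)).map Complex.im = 1 := by
    ext i j; by_cases h : i = j <;> simp [one_apply, h]
  have re2 : (Complex.I • (-w)).map Complex.re = w.map Complex.im := by ext i j; simp
  have im2 : (Complex.I • (-w)).map Complex.im = -w.map Complex.re := by ext i j; simp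
  have hblocks : (fromBlocks A B C D).map Complex.ofReal * fromRows w (1 : Matrix n n ℂ) =
      Complex.I • ((fromBlocks 0 1 (-1) 0 : Matrix (n ⊕ n) (n ⊕ n) ℂ) *
        fromRows w (1 : Matrix n n ℂ)) ↔
      A.map Complex.ofReal * w + B.map Complex.ofReal = Complex.I • (1 : Matrix n n ℂ) ∧
      C.map Complex.ofReal * w + D.map Complex.ofReal = Complex.I • (-w) := by
    have hsmul (M N : Matrix n n ℂ) :
        Complex.I • fromRows M N = fromRows (Complex.I • M) (Complex.I • N) := by
      ext (i | i) j <;> rfl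
    rw [fromBlocks_map, fromBlocks_mul_fromRows, fromBlocks_mul_fromRows, hsmul, fromRows_ext_iff]
    simp
  rw [hblocks, ofReal_mul_add_eq_iff, ofReal_mul_add_eq_iff, re1, im1, re2, im2, SigmaC, SigmaM,
    fromBlocks_inj]
  set l := w.map Complex.re
  set m := w.map Complex.im
  constructor
  · rintro ⟨rfl, rfl, rfl, rfl⟩
    simp [nonsing_inv_mul _ hw, Matrix.mul_assoc]
  · rintro ⟨⟨hB, hA⟩, hD, hC⟩
    have hA' : A = m⁻¹ := (inv_eq_left_inv hA).symm
    have hC' : C = -(l * m⁻¹) := by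
      rw [← Matrix.neg_mul, ← hC, mul_nonsing_inv_cancel_right _ _ hw]
    subst hA' hC'
    refine ⟨rfl, eq_neg_of_add_eq_zero_right hB, rfl, ?_⟩
    rw [Matrix.neg_mul, neg_add_eq_iff_eq_add] at hD
    rw [hD, add_comm]

end SiegelAction

theorem stmt4 (g : ℕ) (w : Matrix (Fin g) (Fin g) ℂ)
    (hw : wᵀ = w) (hwpd : (w.map Complex.im).PosDef)
    (P Q R S : Matrix (Fin g) (Fin g) ℤ)
    (hsymp : (Matrix.fromBlocks P Q R S)ᵀ *
        (Matrix.fromBlocks 0 1 (-1) 0 : Matrix (Fin g ⊕ Fin g) (Fin g ⊕ Fin g) ℤ) *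
        Matrix.fromBlocks P Q R S = Matrix.fromBlocks 0 1 (-1) 0) :
    SigmaC ((P.map (Int.cast : ℤ → ℂ) * w + Q.map (Int.cast : ℤ → ℂ)) *
        (R.map (Int.cast : ℤ → ℂ) * w + S.map (Int.cast : ℤ → ℂ))⁻¹) =
      ((Matrix.fromBlocks P Q R S)⁻¹.map (Int.cast : ℤ → ℝ))ᵀ *
        SigmaC w * ((Matrix.fromBlocks P Q R S)⁻¹.map (Int.cast : ℤ → ℝ)) := by
  set A := P.map (Int.cast : ℤ → ℂ) * w + Q.map (Int.cast : ℤ → ℂ) with hA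
  set C := R.map (Int.cast : ℤ → ℂ) * w + S.map (Int.cast : ℤ → ℂ) with hC
  set G := fromBlocks P Q R S
  set Z : Matrix (Fin g ⊕ Fin g) (Fin g) ℂ := fromRows w (1 : Matrix (Fin g) (Fin g) ℂ) with hZ
  let J : Matrix (Fin g ⊕ Fin g) (Fin g ⊕ Fin g) ℂ := fromBlocks 0 1 (-1) 0
  let Gc := G.map (Int.cast : ℤ → ℂ)
  let Hc := G⁻¹.map (Int.cast : ℤ → ℂ)
  have hGunit : G⁻¹ * G = 1 := by
    refine nonsing_inv_mul _ (isUnit_det_of_left_inverse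
      (B := -(fromBlocks 0 1 (-1) 0 * Gᵀ * fromBlocks 0 1 (-1) 0)) ?_)
    rw [Matrix.neg_mul, Matrix.mul_assoc _ _ G, Matrix.mul_assoc, ← Matrix.mul_assoc Gᵀ, hsymp]
    simp [fromBlocks_multiply, fromBlocks_neg]
  have hHG : Hc * Gc = 1 := by
    have := congrArg (Int.castRingHom ℂ).mapMatrix hGunit
    rwa [map_mul, map_one] at this
  have hGH : Gc * Hc = 1 := mul_eq_one_comm.mp hHG
  have hJ : Gcᵀ * J * Gc = J := by
    have := congrArg (Int.castRingHom ℂ).mapMatrix hsymp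
    have hJmap : (Int.castRingHom ℂ).mapMatrix (fromBlocks 0 1 (-1) 0) = J := by
      ext (i | i) (j | j) <;> simp [J, one_apply, apply_ite]
    rwa [map_mul, map_mul, hJmap] at this
  have hGZ : Gc * Z = fromRows A C := by
    simp [Gc, G, hZ, fromBlocks_map, fromBlocks_mul_fromRows, hA, hC]
  have hGstar : Gcᴴ = Gcᵀ := by ext i j; simp [Gc]
  have hwstar : wᴴ - w = (-2 * Complex.I) • (w.map Complex.im).map Complex.ofReal :=
    conjTranspose_sub_self_of_transpose_eq hw
  have hform (V : Matrix (Fin g) (Fin g ⊕ Fin g) ℂ) : V * Gcᵀ * J * (Gc * Z) = V * J * Z := by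
    conv_rhs => rw [← hJ]
    simp only [Matrix.mul_assoc]
  have hherm : Aᴴ * C - Cᴴ * A = (-2 * Complex.I) • (w.map Complex.im).map Complex.ofReal := by
    have := hform Zᴴ
    rw [← hGstar, ← conjTranspose_mul, hGZ] at this
    rw [← hwstar]
    simpa [J, hZ, conjTranspose_fromRows_eq_fromCols_conjTranspose, fromCols_mul_fromBlocks,
      fromCols_mul_fromRows, sub_eq_add_neg, add_comm] using this
  have hsymm : Aᵀ * C - Cᵀ * A = 0 := by
    have := hform Zᵀ
    rw [← transpose_mul, hGZ] at this
    simpa [J, hZ, transpose_fromRows, fromCols_mul_fromBlocks, hw,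
      fromCols_mul_fromRows, sub_eq_add_neg, add_comm] using this
  have hCunit : IsUnit C.det := by
    rw [isUnit_iff_ne_zero]
    intro hdet
    obtain ⟨v, hv, hCv⟩ := exists_mulVec_eq_zero_iff.mpr hdet
    have h := congrArg (fun M => star v ⬝ᵥ M *ᵥ v) hherm
    have hz : star v ⬝ᵥ (Aᴴ * C - Cᴴ * A) *ᵥ v = 0 := by
      rw [sub_mulVec, ← mulVec_mulVec, ← mulVec_mulVec, hCv, mulVec_zero, zero_sub, dotProduct_neg,
        dotProduct_mulVec, ← star_mulVec, hCv]
      simp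
    simp only [hz, smul_mulVec, dotProduct_smul, smul_eq_mul] at h
    have : (-2 * Complex.I) ≠ 0 := by simp
    exact hv (hwpd.eq_zero_of_star_dotProduct_ofReal_mulVec
      ((mul_eq_zero.mp h.symm).resolve_left this))
  have hAC : A = A * C⁻¹ * C := (nonsing_inv_mul_cancel_right _ _ hCunit).symm
  set w' := A * C⁻¹
  have hw' : w'ᵀ = w' := by
    rw [hAC, transpose_mul, Matrix.mul_assoc, ← Matrix.mul_sub, ← Matrix.sub_mul] at hsymm
    have := congrArg (fun M => (Cᵀ)⁻¹ * M * C⁻¹) hsymm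
    have hCt : IsUnit Cᵀ.det := by rwa [det_transpose]
    simp only [Matrix.mul_assoc, nonsing_inv_mul_cancel_left _ _ hCt,
      mul_nonsing_inv _ hCunit] at this
    simpa [sub_eq_zero] using this
  have hwstar' : w'ᴴ - w' = (-2 * Complex.I) • (w'.map Complex.im).map Complex.ofReal :=
    conjTranspose_sub_self_of_transpose_eq hw'
  have him : IsUnit (w'.map Complex.im).det := by
    rw [hAC, conjTranspose_mul, Matrix.mul_assoc, ← Matrix.mul_sub, ← Matrix.sub_mul, hwstar',
      Matrix.smul_mul, Matrix.mul_smul] at hherm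
    have hdet := congrArg det (smul_right_injective _ (by simp : (-2 * Complex.I) ≠ 0) hherm)
    have hmapdet (m : Matrix (Fin g) (Fin g) ℝ) : (m.map Complex.ofReal).det = (m.det : ℂ) :=
      (Complex.ofRealHom.map_det m).symm
    rw [det_mul, det_mul, hmapdet, hmapdet] at hdet
    rw [isUnit_iff_ne_zero]
    intro h0
    rw [h0] at hdet
    simp only [Complex.ofReal_zero, zero_mul, mul_zero] at hdet
    exact hwpd.det_pos.ne (Complex.ofReal_injective hdet)
  symm
  rw [eq_SigmaC_iff _ _ him]
  have hSig : (SigmaC w).map Complex.ofReal * Z = Complex.I • (J * Z) := (eq_SigmaC_iff _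
    w hwpd.det_pos.ne'.isUnit).mp rfl
  have hmap : (((G⁻¹).map (Int.cast : ℤ → ℝ))ᵀ * SigmaC w *
      (G⁻¹).map (Int.cast : ℤ → ℝ)).map Complex.ofReal =
      Hcᵀ * (SigmaC w).map Complex.ofReal * Hc := by
    have hcast : (G⁻¹.map (Int.cast : ℤ → ℝ)).map Complex.ofReal = Hc := by ext i j; simp [Hc]
    change Complex.ofRealHom.mapMatrix _ = _
    rw [map_mul, map_mul, ← hcast]
    rfl
  have hGZ' : Gc * Z = fromRows w' (1 : Matrix (Fin g) (Fin g) ℂ) * C := by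
    rw [hGZ, fromRows_mul, ← hAC, Matrix.one_mul]
  have hZ' : fromRows w' (1 : Matrix (Fin g) (Fin g) ℂ) = Gc * Z * C⁻¹ := by
    rw [hGZ', Matrix.mul_assoc, mul_nonsing_inv _ hCunit, Matrix.mul_one]
  have hJG : Hcᵀ * J = J * Gc := by
    rw [← hJ, ← Matrix.mul_assoc, ← Matrix.mul_assoc, ← transpose_mul, hGH]
    simp [hJ]
  calc _ = Hcᵀ * ((SigmaC w).map Complex.ofReal * ((Hc * Gc) * Z)) * C⁻¹ := by
        rw [hmap, hZ']; simp only [Matrix.mul_assoc]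
    _ = Complex.I • (Hcᵀ * J * Z * C⁻¹) := by
        rw [hHG, Matrix.one_mul, hSig]; simp [J, Matrix.mul_assoc]
    _ = _ := by rw [hJG, hZ']; simp only [J, Matrix.mul_assoc]
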